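/- Let U and V be independent standard Gaussian random variables. Then for every nonnegative integer n and every positive integer r, E[U^{2n} V^{2n} (U² − V²)^{2r}] = 2^{2n+4r} · (1/2)_n · (1/2)_r · (1/2)_{n+r}. -/

import Mathlib

open MeasureTheory ProbabilityTheory

/-- The rising factorial `(α)_k = α (α+1) ⋯ (α+k-1)`, with `(α)_0 = 1`. -/
def risingFactorial (α : ℝ) (k : ℕ) : ℝ := ∏ j ∈ Finset.range k, (α + j)

lemma risingFactorial_zero (α : ℝ) : risingFactorial α 0 = 1 := by
  simp [risingFactorial]

lemma risingFactorial_succ (α : ℝ) (k : ℕ) :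
    risingFactorial α (k + 1) = risingFactorial α k * (α + k) := by
  simp [risingFactorial, Finset.prod_range_succ]

lemma integral_pow_even_gaussianReal_eq_Gamma (k : ℕ) :
    ∫ x, x ^ (2 * k) ∂(gaussianReal 0 1) =
      2 ^ k * Real.Gamma (k + 1 / 2) / Real.sqrt Real.pi := by
  have habs : ∀ x : ℝ, gaussianPDFReal 0 1 x • x ^ (2 * k) =
      (fun y : ℝ ↦ (Real.sqrt (2 * Real.pi))⁻¹ * (y ^ (2 * k) * Real.exp (-(1 / 2) * y ^ 2)))
        |x| := by
    intro x
    simp only [gaussianPDFReal, smul_eq_mul, NNReal.coe_one, mul_one, sub_zero, sq_abs,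
      pow_mul]
    rw [show -x ^ 2 / 2 = -(1 / 2) * x ^ 2 by ring]
    ring
  have hΓ := integral_rpow_mul_exp_neg_mul_rpow (p := 2) (q := (2 * k : ℕ)) (b := 1 / 2)
    (by norm_num) (lt_of_lt_of_le (by norm_num) (Nat.cast_nonneg _)) (by norm_num)
  rw [integral_gaussianReal_eq_integral_smul one_ne_zero, integral_congr_ae (ae_of_all _ habs),
    integral_comp_abs (f := fun y : ℝ ↦
      (Real.sqrt (2 * Real.pi))⁻¹ * (y ^ (2 * k) * Real.exp (-(1 / 2) * y ^ 2))),
    integral_const_mul]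
  simp only [Real.rpow_natCast, Real.rpow_two] at hΓ
  rw [hΓ, show (((2 * k : ℕ) : ℝ) + 1) / 2 = k + 1 / 2 by push_cast; ring,
    show -(((2 * k : ℕ) : ℝ) + 1) / 2 = -(k + 1 / 2) by push_cast; ring,
    one_div, Real.inv_rpow (by norm_num), ← Real.rpow_neg (by norm_num), neg_neg,
    Real.rpow_add (by norm_num), Real.rpow_natCast,
    show (2 : ℝ) ^ (2⁻¹ : ℝ) = Real.sqrt 2 by rw [Real.sqrt_eq_rpow, one_div],
    Real.sqrt_mul (by norm_num)]
  field_simp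

lemma integral_pow_even_gaussianReal (k : ℕ) :
    ∫ x, x ^ (2 * k) ∂(gaussianReal 0 1) = 2 ^ k * risingFactorial (1 / 2) k := by
  rw [integral_pow_even_gaussianReal_eq_Gamma]
  have h : Real.Gamma (k + 1 / 2) = risingFactorial (1 / 2) k * Real.sqrt Real.pi := by
    induction k with
    | zero => rw [risingFactorial_zero, Nat.cast_zero, zero_add, Real.Gamma_one_half_eq, one_mul]
    | succ k ih =>
      rw [Nat.cast_succ, show (k : ℝ) + 1 + 1 / 2 = (k + 1 / 2) + 1 by ring,
        Real.Gamma_add_one (by positivity), ih, risingFactorial_succ]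
      ring
  have : Real.sqrt Real.pi ≠ 0 := by positivity
  rw [h]
  field_simp

section Moments

variable {Ω : Type*}

/-- The function `U^{2i} V^{2j} (U² - V²)^s`. -/
def evenProductPow (U V : Ω → ℝ) (i j s : ℕ) (ω : Ω) : ℝ :=
  U ω ^ (2 * i) * V ω ^ (2 * j) * (U ω ^ 2 - V ω ^ 2) ^ s

lemma evenProductPow_succ (U V : Ω → ℝ) (i j s : ℕ) :
    evenProductPow U V i j (s + 1) =
      fun ω ↦ evenProductPow U V (i + 1) j s ω - evenProductPow U V i (j + 1) s ω := by
  ext ω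
  simp only [evenProductPow]
  ring

variable [MeasurableSpace Ω] {P : Measure Ω} {U V : Ω → ℝ}

lemma aemeasurable_of_map_eq_gaussianReal (hU : Measure.map U P = gaussianReal 0 1) :
    AEMeasurable U P :=
  AEMeasurable.of_map_ne_zero (hU ▸ IsProbabilityMeasure.ne_zero _)

lemma integrable_pow_of_map_eq_gaussianReal (hU : Measure.map U P = gaussianReal 0 1) (k : ℕ) :
    Integrable (fun ω ↦ U ω ^ k) P := by
  have h : Integrable (fun x : ℝ ↦ x ^ k) (Measure.map U P) := by
    rw [hU]
    have := (memLp_id_gaussianReal (μ := 0) (v := 1) k).integrable_norm_pow'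
    refine this.mono (by fun_prop) (ae_of_all _ fun x ↦ ?_)
    simp
  exact h.comp_aemeasurable (aemeasurable_of_map_eq_gaussianReal hU)

lemma integral_pow_even_of_map_eq_gaussianReal (hU : Measure.map U P = gaussianReal 0 1)
    (k : ℕ) : ∫ ω, U ω ^ (2 * k) ∂P = 2 ^ k * risingFactorial (1 / 2) k := by
  rw [← integral_pow_even_gaussianReal, ← hU,
    integral_map (aemeasurable_of_map_eq_gaussianReal hU) (by fun_prop)]

lemma indepFun_pow (hindep : IndepFun U V P) (i j : ℕ) :
    IndepFun (fun ω ↦ U ω ^ i) (fun ω ↦ V ω ^ j) P :=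
  hindep.comp (φ := (· ^ i)) (ψ := (· ^ j)) (by fun_prop) (by fun_prop)

lemma integral_pow_mul_pow (hU : Measure.map U P = gaussianReal 0 1)
    (hV : Measure.map V P = gaussianReal 0 1) (hindep : IndepFun U V P) (i j : ℕ) :
    ∫ ω, U ω ^ (2 * i) * V ω ^ (2 * j) ∂P =
      2 ^ (i + j) * risingFactorial (1 / 2) i * risingFactorial (1 / 2) j := by
  rw [(indepFun_pow hindep _ _).integral_fun_mul_eq_mul_integral
      (integrable_pow_of_map_eq_gaussianReal hU _).aestronglyMeasurable
      (integrable_pow_of_map_eq_gaussianReal hV _).aestronglyMeasurable,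
    integral_pow_even_of_map_eq_gaussianReal hU, integral_pow_even_of_map_eq_gaussianReal hV]
  ring

lemma integrable_evenProductPow (hU : Measure.map U P = gaussianReal 0 1)
    (hV : Measure.map V P = gaussianReal 0 1) (hindep : IndepFun U V P) (i j s : ℕ) :
    Integrable (evenProductPow U V i j s) P := by
  induction s generalizing i j with
  | zero =>
    have h := (indepFun_pow hindep (2 * i) (2 * j)).integrable_mul
      (integrable_pow_of_map_eq_gaussianReal hU _) (integrable_pow_of_map_eq_gaussianReal hV _)
    refine h.congr (ae_of_all _ fun ω ↦ ?_)
    simp [evenProductPow]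
  | succ s ih =>
    rw [evenProductPow_succ]
    exact (ih _ _).sub (ih _ _)

lemma integral_evenProductPow_succ (hU : Measure.map U P = gaussianReal 0 1)
    (hV : Measure.map V P = gaussianReal 0 1) (hindep : IndepFun U V P) (i j s : ℕ) :
    ∫ ω, evenProductPow U V i j (s + 1) ω ∂P =
      ∫ ω, evenProductPow U V (i + 1) j s ω ∂P - ∫ ω, evenProductPow U V i (j + 1) s ω ∂P := by
  rw [evenProductPow_succ]
  exact integral_sub (integrable_evenProductPow hU hV hindep _ _ _)
    (integrable_evenProductPow hU hV hindep _ _ _)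

lemma integral_evenProductPow_zero (hU : Measure.map U P = gaussianReal 0 1)
    (hV : Measure.map V P = gaussianReal 0 1) (hindep : IndepFun U V P) (i j : ℕ) :
    ∫ ω, evenProductPow U V i j 0 ω ∂P =
      2 ^ (i + j) * risingFactorial (1 / 2) i * risingFactorial (1 / 2) j := by
  simpa [evenProductPow] using integral_pow_mul_pow hU hV hindep i j

/-- Multiplying a homogeneous integrand of degree `d = 2(i + j + s)` by `U² + V²`
multiplies its expectation by `d + 2`. -/
lemma integral_evenProductPow_add (hU : Measure.map U P = gaussianReal 0 1)
    (hV : Measure.map V P = gaussianReal 0 1) (hindep : IndepFun U V P) (i j s : ℕ) :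
    ∫ ω, evenProductPow U V (i + 1) j s ω ∂P + ∫ ω, evenProductPow U V i (j + 1) s ω ∂P =
      (2 * (i + j + s) + 2) * ∫ ω, evenProductPow U V i j s ω ∂P := by
  induction s generalizing i j with
  | zero =>
    simp only [integral_evenProductPow_zero hU hV hindep, risingFactorial_succ]
    push_cast
    ring
  | succ s ih =>
    have h₁ := ih (i + 1) j
    have h₂ := ih i (j + 1)
    simp only [integral_evenProductPow_succ hU hV hindep]
    push_cast at h₁ h₂ ⊢
    linear_combination h₁ - h₂

lemma integral_evenProductPow_diagonal (hU : Measure.map U P = gaussianReal 0 1)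
    (hV : Measure.map V P = gaussianReal 0 1) (hindep : IndepFun U V P) (n r : ℕ) :
    ∫ ω, evenProductPow U V n n (2 * r) ω ∂P =
      2 ^ (2 * n + 4 * r) * risingFactorial (1 / 2) n * risingFactorial (1 / 2) r *
        risingFactorial (1 / 2) (n + r) := by
  induction r generalizing n with
  | zero =>
    rw [mul_zero, integral_evenProductPow_zero hU hV hindep, risingFactorial_zero, add_zero]
    ring
  | succ r ih =>
    have h₁ := integral_evenProductPow_add hU hV hindep (n + 1) n (2 * r)
    have h₂ := integral_evenProductPow_add hU hV hindep n (n + 1) (2 * r)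
    have h₃ := integral_evenProductPow_add hU hV hindep n n (2 * r)
    have h₄ := ih (n + 1)
    rw [show n + 1 + r = n + r + 1 by ring, risingFactorial_succ, risingFactorial_succ] at h₄
    rw [ih n] at h₃
    rw [show 2 * (r + 1) = 2 * r + 1 + 1 by ring, ← add_assoc n r 1, risingFactorial_succ,
      risingFactorial_succ]
    simp only [integral_evenProductPow_succ hU hV hindep]
    push_cast at h₁ h₂ h₃ h₄ ⊢
    linear_combination h₁ + h₂ + (4 * n + 4 * r + 4) * h₃ - 4 * h₄

end Moments

/-- For independent standard Gaussians `U, V`, a nonnegative integer `n` and a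
positive integer `r`:
`E[U^{2n} V^{2n} (U² - V²)^{2r}] = 2^{2n+4r} (1/2)_n (1/2)_r (1/2)_{n+r}`. -/
theorem gaussian_symmetric_moment_identity
    {Ω : Type*} [MeasurableSpace Ω] (P : Measure Ω) [IsProbabilityMeasure P]
    (U V : Ω → ℝ)
    (hU : Measure.map U P = gaussianReal 0 1)
    (hV : Measure.map V P = gaussianReal 0 1)
    (hindep : IndepFun U V P)
    (n r : ℕ) (hr : 0 < r) :
    (∫ ω, (U ω) ^ (2 * n) * (V ω) ^ (2 * n) * ((U ω) ^ 2 - (V ω) ^ 2) ^ (2 * r) ∂P)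
      = 2 ^ (2 * n + 4 * r) * risingFactorial (1 / 2) n * risingFactorial (1 / 2) r *
          risingFactorial (1 / 2) (n + r) := by
  exact integral_evenProductPow_diagonal hU hV hindep n r
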